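/- Under the Setup, the shape of the Le diagram of V consists, from left to right, of a rectangle that is 3 columns wide, one further column of the same height as the rectangle, and a partition shape with at most as many rows as the rectangle; and the shape of the Le diagram of W consists, from left to right, of a rectangle with 3 columns and one more row than the rectangle of V, followed by the same partition shape as in V. -/

import Mathlib

open scoped Classical

namespace WLD

/-- A propagator of a Wilson loop diagram on the cyclically ordered vertex set
`ZMod n` (vertex `n` is identified with `0`): an unordered pair of edges, the
edge joining vertex `i` to vertex `i+1` being labelled `i`. -/
abbrev Prp (n : ℕ) := Sym2 (ZMod n)

variable (n : ℕ)

/-- The position of `x` in the linear order `i <_i i+1 <_i ⋯ <_i i-1`. -/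
def ord (i x : ZMod n) : ℕ := (x - i).val

/-- The other end of a propagator `p` having an end on the edge `e`. -/
noncomputable def otherEnd (p : Prp n) (e : ZMod n) : ZMod n :=
  if h : e ∈ p then Sym2.Mem.other h else e

/-- The vertex support `V(p) = {i, i+1, j, j+1}` of the propagator `p = (i,j)`. -/
def supp (p : Prp n) : Finset (ZMod n) :=
  Sym2.lift ⟨fun i j => {i, i + 1, j, j + 1}, fun i j => by
    ext x
    simp only [Finset.mem_insert, Finset.mem_singleton]
    tauto⟩ p

/-- The vertex support `V(Q)` of a set of propagators. -/
def suppSet (Q : Finset (Prp n)) : Finset (ZMod n) := Q.biUnion (supp n)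

/-- `Prop(U)`: the propagators of `P` supported on (a vertex of) `U`. -/
noncomputable def propsOn (P : Finset (Prp n)) (U : Finset (ZMod n)) : Finset (Prp n) :=
  P.filter fun p => (supp n p ∩ U).Nonempty

/-- Two propagators `p = (i,j)` and `q = (k,l)` cross if `i < k < j < l` cyclically. -/
def Crossing (p q : Prp n) : Prop :=
  ∃ i j k l : ZMod n, p = s(i, j) ∧ q = s(k, l) ∧
    0 < ord n i k ∧ ord n i k < ord n i j ∧ ord n i j < ord n i l

/-- Weak admissibility of a Wilson loop diagram. -/
structure IsWeaklyAdmissible (P : Finset (Prp n)) : Prop where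
  dense : ∀ Q ⊆ P, Q.Nonempty → Q.card + 3 ≤ (suppSet n Q).card
  noncross : ∀ p ∈ P, ∀ q ∈ P, ¬ Crossing n p q

/-- Admissibility of a Wilson loop diagram. -/
structure IsAdmissible (P : Finset (Prp n)) : Prop where
  card_add_four_le : P.card + 4 ≤ n
  dense : ∀ Q ⊆ P, Q.Nonempty → Q.card + 3 ≤ (suppSet n Q).card
  noncross : ∀ p ∈ P, ∀ q ∈ P, ¬ Crossing n p q

/-- The length of a propagator `p = (i,j)`:
`min(|[i+1, j]|, |[j+1, i]|)`, the number of vertices on its smaller side. -/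
def plength (p : Prp n) : ℕ :=
  Sym2.lift ⟨fun i j => min ((j - i - 1).val + 1) ((i - j - 1).val + 1),
    fun _ _ => min_comm _ _⟩ p

/-- `InsideDir n i p q` : the propagator `q = (k,l)` lies (weakly) inside the
propagator `p = (i,j)` directed from its end `i`, i.e. `i ≤_i k <_i l ≤_i j`. -/
def InsideDir (i : ZMod n) (p q : Prp n) : Prop :=
  ∃ j k l : ZMod n, p = s(i, j) ∧ q = s(k, l) ∧
    ord n i k < ord n i l ∧ ord n i l ≤ ord n i j

/-- Sorting key measuring how far clockwise of the vertex `a` the relevant end of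
a propagator supported on `a` is attached: ends on the edge `a-1` are clockwise of
ends on the edge `a`, and on a fixed edge an end is the more clockwise the larger
the propagator is (nestedness of noncrossing propagators sharing an edge). -/
noncomputable def cwKey (a : ZMod n) (p : Prp n) : ℕ :=
  if a - 1 ∈ p then n + ord n (a - 1) (otherEnd n p (a - 1))
  else ord n a (otherEnd n p a)

/-- The clockwise-most propagator of `S` supported on the vertex `a`, if any. -/
noncomputable def pickCW (S : Finset (Prp n)) (a : ZMod n) : Option (Prp n) :=
  if h : (S.filter fun p => a ∈ supp n p).Nonempty then
    some (Classical.choose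
      ((S.filter fun p => a ∈ supp n p).exists_max_image (cwKey n a) h))
  else none

/-- The Grassmann necklace algorithm started at the vertex `i`: after `t` steps,
`(gnRun n P i t).1` is the set of propagators not yet deleted, and
`(gnRun n P i t).2` records the vertex assigned to each deleted propagator.
Step `t+1` processes the vertex `i + t`: if some not-yet-deleted propagator is
supported on it, the clockwise-most such propagator is deleted and assigned
that vertex. -/
noncomputable def gnRun (P : Finset (Prp n)) (i : ZMod n) :
    ℕ → Finset (Prp n) × (Prp n → Option (ZMod n))
  | 0 => (P, fun _ => none)
  | t + 1 =>
    match pickCW n (gnRun P i t).1 (i + (t : ZMod n)) with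
    | none => gnRun P i t
    | some p => ((gnRun P i t).1.erase p,
        Function.update (gnRun P i t).2 p (some (i + (t : ZMod n))))

/-- `I_i^W(p)`: the vertex contributed by the propagator `p` to the Grassmann
necklace term `I_i^W` (as an `Option`; the algorithm makes one full circuit of
the vertex set, i.e. runs for `n` steps). -/
noncomputable def gnAssign (P : Finset (Prp n)) (i : ZMod n) (p : Prp n) :
    Option (ZMod n) :=
  (gnRun n P i n).2 p

/-- The Grassmann necklace term `I_i^W` produced by the algorithm. -/
noncomputable def gnSet [NeZero n] (P : Finset (Prp n)) (i : ZMod n) :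
    Finset (ZMod n) :=
  Finset.univ.filter fun v => ∃ p, gnAssign n P i p = some v

/-- The cyclic interval `{a, a+1, …, a + (len-1)}` in `ZMod n`. -/
def cInterval [NeZero n] (a : ZMod n) (len : ℕ) : Finset (ZMod n) :=
  Finset.univ.filter fun x => ord n a x < len

/-- A Grassmann necklace of type `(k, n)`: a cyclic sequence of `k`-element
subsets of the vertex set such that `I_{i+1} = (I_i \ {i}) ∪ {j}` for some `j`
whenever `i ∈ I_i`, and `I_{i+1} = I_i` otherwise. -/
def IsGrassmannNecklace [NeZero n] (k : ℕ) (I : ZMod n → Finset (ZMod n)) : Prop :=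
  (∀ i, (I i).card = k) ∧
  ∀ i : ZMod n,
    (i ∈ I i → ∃ j : ZMod n, I (i + 1) = insert j ((I i).erase i)) ∧
    (i ∉ I i → I (i + 1) = I i)

/-- Independence in the matroid `M(W)`: no subset `U` of `J` supports fewer
propagators than the vertices it contains. -/
def Indep (P : Finset (Prp n)) (J : Finset (ZMod n)) : Prop :=
  ∀ U ⊆ J, U.card ≤ (propsOn n P U).card

/-- `A` is lexicographically smaller than `B` with respect to the order `<_i`:
the `<_i`-least element of the symmetric difference lies in `A`. -/
def LexLt (i : ZMod n) (A B : Finset (ZMod n)) : Prop :=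
  ∃ v, v ∈ A ∧ v ∉ B ∧ ∀ w, ord n i w < ord n i v → (w ∈ A ↔ w ∈ B)

/-- A `+` is placed in the box `(a, b)` of the Le diagram with row labels `I₁`
by the necklace term `Ii`: writing `I₁ \ Ii = {a₁ > ⋯ > a_r}` and
`Ii \ I₁ = {b₁ < ⋯ < b_r}` in the `<₁` order, the plusses are in the boxes
`(a_t, b_t)`. -/
def LePlusAt (I₁ Ii : Finset (ZMod n)) (a b : ZMod n) : Prop :=
  a ∈ I₁ \ Ii ∧ b ∈ Ii \ I₁ ∧
    ((I₁ \ Ii).filter fun x => ord n 1 a < ord n 1 x).card =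
      ((Ii \ I₁).filter fun y => ord n 1 y < ord n 1 b).card

/-- The box `(a, b)` of the Le diagram of the diagram `P` contains a `+`. -/
def LePlus [NeZero n] (P : Finset (Prp n)) (a b : ZMod n) : Prop :=
  ∃ i : ZMod n, LePlusAt n (gnSet n P 1) (gnSet n P i) a b

/-- The number of `+` entries in the Le diagram of the diagram `P`. -/
noncomputable def plusCount [NeZero n] (P : Finset (Prp n)) : ℕ :=
  (Finset.univ.filter fun ab : ZMod n × ZMod n => LePlus n P ab.1 ab.2).card

/-- The length of the row labelled `a` of the Young diagram with row labels `I₁`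
(the boxes of row `a` are indexed by the column labels `b ∉ I₁` with `a <₁ b`). -/
noncomputable def rowLen [NeZero n] (I₁ : Finset (ZMod n)) (a : ZMod n) : ℕ :=
  (Finset.univ.filter fun b => b ∉ I₁ ∧ ord n 1 a < ord n 1 b).card

/-- The entry of the matrix `C(W)` in row `p` and column `q`: the indeterminate
`x_{p,q}` if `q ∈ V(p)`, and `0` otherwise. -/
noncomputable def CW (p : Prp n) (q : ZMod n) : MvPolynomial (Prp n × ZMod n) ℝ :=
  if q ∈ supp n p then MvPolynomial.X (p, q) else 0

/-- The column paired with the row `p` in the minors determined by `I_i^W`. -/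
noncomputable def colOf (P : Finset (Prp n)) (i : ZMod n) (p : Prp n) : ZMod n :=
  (gnAssign n P i p).getD i

/-- `Δ_{I_i}`: the determinant of the `k × k` minor of `C(W)` on the columns
indexed by `I_i^W`, rows and columns paired via the necklace assignment. -/
noncomputable def Delta (P : Finset (Prp n)) (i : ZMod n) :
    MvPolynomial (Prp n × ZMod n) ℝ :=
  Matrix.det (Matrix.of fun p q : ↥P => CW n (p : Prp n) (colOf n P i (q : Prp n)))

/-- `S_i`: the propagators whose contribution changes from `I_{i-1}` to `I_i`. -/
noncomputable def Schanged (P : Finset (Prp n)) (i : ZMod n) : Finset (Prp n) :=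
  P.filter fun p => gnAssign n P (i - 1) p ≠ gnAssign n P i p

/-- `r_i`: the determinant of the minor of `C(W)` with rows indexed by `S_i` and
columns indexed by `I_i(S_i)` (equal to `1` when `S_i = ∅`). -/
noncomputable def rfac (P : Finset (Prp n)) (i : ZMod n) :
    MvPolynomial (Prp n × ZMod n) ℝ :=
  Matrix.det
    (Matrix.of fun p q : ↥(Schanged n P i) => CW n (p : Prp n) (colOf n P i (q : Prp n)))

/-- `R = ∏ᵢ rᵢ`, the polynomial produced by the algorithm. -/
noncomputable def Rpoly [NeZero n] (P : Finset (Prp n)) :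
    MvPolynomial (Prp n × ZMod n) ℝ :=
  ∏ i : ZMod n, rfac n P i

/-- Position of the end of the propagator `p` along the edge `e`: larger values
attach closer to the vertex `e`, i.e. earlier in the counterclockwise ordering
of the ends of propagators along the edge `e`. -/
noncomputable def edgeKey (e : ZMod n) (p : Prp n) : ℕ := ord n e (otherEnd n p e)

/-- The propagators of `P` with an end on the edge `e`. -/
noncomputable def onEdge (P : Finset (Prp n)) (e : ZMod n) : Finset (Prp n) :=
  P.filter fun p => e ∈ p

/-- `p` is the first propagator (`p₁`) on the edge `e` in the counterclockwise
ordering of the propagators with an end on the edge `e`. -/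
def IsCcwFirst (P : Finset (Prp n)) (e : ZMod n) (p : Prp n) : Prop :=
  p ∈ onEdge n P e ∧ ∀ q ∈ onEdge n P e, edgeKey n e q ≤ edgeKey n e p

/-- `p` is the last propagator (`p_r`) on the edge `e` in the counterclockwise
ordering of the propagators with an end on the edge `e`. -/
def IsCcwLast (P : Finset (Prp n)) (e : ZMod n) (p : Prp n) : Prop :=
  p ∈ onEdge n P e ∧ ∀ q ∈ onEdge n P e, edgeKey n e p ≤ edgeKey n e q

/-- `p` and `q` are consecutive, in this order (`p = p_j`, `q = p_{j+1}`), in the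
counterclockwise ordering of the propagators with an end on the edge `e`. -/
def ConsecOnEdge (P : Finset (Prp n)) (e : ZMod n) (p q : Prp n) : Prop :=
  p ∈ onEdge n P e ∧ q ∈ onEdge n P e ∧ edgeKey n e q < edgeKey n e p ∧
    ∀ r ∈ onEdge n P e, ¬ (edgeKey n e q < edgeKey n e r ∧ edgeKey n e r < edgeKey n e p)

/-- The factor `R_e` of the denominator `R(W)` associated to the edge `e`:
`R_e = x_{p₁,e+1} • ∏_{j=1}^{r-1} (x_{p_j,e} x_{p_{j+1},e+1} - x_{p_{j+1},e} x_{p_j,e+1}) • x_{p_r,e}`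
for the counterclockwise ordering `p₁, …, p_r` of the propagators on the edge `e`
(`R_e = 1` if there are none). -/
noncomputable def Redge (P : Finset (Prp n)) (e : ZMod n) :
    MvPolynomial (Prp n × ZMod n) ℝ :=
  (∏ p ∈ (onEdge n P e).filter (IsCcwFirst n P e), MvPolynomial.X (p, e + 1)) *
    (∏ pq ∈ (P ×ˢ P).filter (fun pq => ConsecOnEdge n P e pq.1 pq.2),
      (MvPolynomial.X (pq.1, e) * MvPolynomial.X (pq.2, e + 1) -
        MvPolynomial.X (pq.2, e) * MvPolynomial.X (pq.1, e + 1))) *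
    (∏ p ∈ (onEdge n P e).filter (IsCcwLast n P e), MvPolynomial.X (p, e))

/-- The denominator `R(W) = ∏ₑ R_e` of the integrand `Ω(W)`. -/
noncomputable def RW [NeZero n] (P : Finset (Prp n)) :
    MvPolynomial (Prp n × ZMod n) ℝ :=
  ∏ e : ZMod n, Redge n P e

/-- The relabelling map associated to the removal of the vertex `i` from the
vertex set `ZMod n`: the vertex of `ZMod (n-1)` in position `t` (in the `<₁`
order) is sent to the vertex of `ZMod n` in position `t` if `t` precedes the
position of `i`, and to the vertex in position `t+1` otherwise. -/
noncomputable def liftVert (i : ZMod n) (x : ZMod (n - 1)) : ZMod n :=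
  1 + ((if ord (n - 1) 1 x < ord n 1 i then ord (n - 1) 1 x
        else ord (n - 1) 1 x + 1 : ℕ) : ZMod n)

end WLD
namespace WLD

/-- The diagram `V` of the Setup: the diagram `W` with the length-2 propagator
`p = (n-3, n-1)` removed. -/
noncomputable def eraseP (n : ℕ) (P : Finset (Prp n)) : Finset (Prp n) :=
  P.erase (s(-3, -1) : Prp n)

section LinearMatching

/-- The linear version of the support: a propagator is recorded by its smaller edge `lo` and its
larger edge `hi`. -/
def linSupp (lo hi : ℕ) : Finset ℕ := {lo, lo + 1, hi, hi + 1}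

/-- The clockwise sorting key at the vertex `v`, in linear coordinates. -/
def linKey (n v lo hi : ℕ) : ℕ :=
  if lo + 1 = v then n + (hi - lo)
  else if hi + 1 = v then n + (n - (hi - lo))
  else if lo = v then hi - lo
  else n - (hi - lo)

/-- Hall's condition for matching `S` into the vertices `v, …, m`. -/
def HallFrom {ι : Type*} (lo hi : ι → ℕ) (S : Finset ι) (v m : ℕ) : Prop :=
  ∀ Q ⊆ S, Q.card ≤ ((Q.biUnion fun i => linSupp (lo i) (hi i)) ∩ Finset.Icc v m).card

lemma mem_linSupp {lo hi x : ℕ} :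
    x ∈ linSupp lo hi ↔ x = lo ∨ x = lo + 1 ∨ x = hi ∨ x = hi + 1 := by
  simp [linSupp]

/-- If `(a, b)` is clockwise-most at `v`, every propagator that does not lie inside `(a, b)` meets
the vertices from `v` on only from `b` on. -/
lemma le_of_linKey_le {n v a b c d x : ℕ} (ha : a = v ∨ a + 1 = v) (hab : a + 2 ≤ b)
    (hcd : c + 2 ≤ d) (hb : b < n) (hd : d < n)
    (hnc : ¬ (c < a ∧ a < d ∧ d < b)) (hnc' : ¬ (a < c ∧ c < b ∧ b < d))
    (hkey : v = c ∨ v = c + 1 ∨ v = d ∨ v = d + 1 → linKey n v c d ≤ linKey n v a b)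
    (hout : ¬ (a ≤ c ∧ d ≤ b)) (hx : x = c ∨ x = c + 1 ∨ x = d ∨ x = d + 1) (hvx : v ≤ x) :
    b ≤ x := by
  by_contra! hlt
  by_cases hv : v = c ∨ v = c + 1 ∨ v = d ∨ v = d + 1
  · have := hkey hv
    clear hkey
    rcases ha with rfl | rfl
    · have hk : linKey n a a b = b - a := by
        unfold linKey
        rw [if_neg (by omega), if_neg (by omega), if_pos rfl]
      rw [hk, linKey] at this
      split_ifs at this <;> omega
    · have hk : linKey n (a + 1) a b = n + (b - a) := if_pos rfl
      rw [hk, linKey] at this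
      split_ifs at this <;> omega
  · clear hkey
    omega

variable {ι : Type*} {lo hi : ι → ℕ} {S : Finset ι} {v m : ℕ}

lemma HallFrom.succ_of_notMem (h : HallFrom lo hi S v m)
    (hv : ∀ i ∈ S, v ∉ linSupp (lo i) (hi i)) : HallFrom lo hi S (v + 1) m := by
  intro Q hQ
  refine (h Q hQ).trans (Finset.card_le_card fun x hx => ?_)
  simp only [Finset.mem_inter, Finset.mem_biUnion, Finset.mem_Icc] at hx ⊢
  obtain ⟨⟨i, hi, hx⟩, h1, h2⟩ := hx
  have : x ≠ v := by rintro rfl; exact hv i (hQ hi) hx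
  exact ⟨⟨i, hi, hx⟩, by omega, h2⟩

/-- Deleting the clockwise-most propagator at `v` preserves Hall's condition. -/
lemma HallFrom.succ_erase [DecidableEq ι] {n : ℕ} (h : HallFrom lo hi S v m) (hvm : v ≤ m) (hv1 : 1 ≤ v)
    (hlo : ∀ i ∈ S, lo i + 2 ≤ hi i) (hhi : ∀ i ∈ S, hi i < n)
    (hnc : ∀ i ∈ S, ∀ j ∈ S, ¬ (lo i < lo j ∧ lo j < hi i ∧ hi i < hi j))
    (hdense : ∀ Q ⊆ S, Q.Nonempty →
      Q.card + 3 ≤ (Q.biUnion fun i => linSupp (lo i) (hi i)).card)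
    {p : ι} (hpS : p ∈ S) (hpv : v ∈ linSupp (lo p) (hi p))
    (hmax : ∀ i ∈ S, v ∈ linSupp (lo i) (hi i) →
      linKey n v (lo i) (hi i) ≤ linKey n v (lo p) (hi p)) :
    HallFrom lo hi (S.erase p) (v + 1) m := by
  intro Q hQ
  by_contra! hlt
  set N : Finset ι → Finset ℕ := fun Q => Q.biUnion fun i => linSupp (lo i) (hi i) with hN
  have memN : ∀ Q x, x ∈ N Q ↔ ∃ i ∈ Q, x ∈ linSupp (lo i) (hi i) := by simp [hN]
  have hQS : Q ⊆ S := hQ.trans (Finset.erase_subset _ _)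
  have hpQ : p ∉ Q := fun h => by simpa using hQ h
  have hsub : N Q ∩ Finset.Icc v m ⊆ insert v (N Q ∩ Finset.Icc (v + 1) m) := by
    intro x
    simp only [Finset.mem_inter, Finset.mem_insert, Finset.mem_Icc]
    rintro ⟨hx, h1, h2⟩
    rcases h1.eq_or_lt with rfl | h1
    · exact Or.inl rfl
    · exact Or.inr ⟨hx, h1, h2⟩
  have htight : (N Q ∩ Finset.Icc v m).card ≤ Q.card :=
    (Finset.card_le_card hsub).trans ((Finset.card_insert_le _ _).trans hlt)
  obtain ⟨s, hsQ, hsv⟩ : ∃ s ∈ Q, v ∈ linSupp (lo s) (hi s) := by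
    by_contra! hno
    have : N Q ∩ Finset.Icc v m ⊆ N Q ∩ Finset.Icc (v + 1) m := by
      intro x hx
      rcases Finset.mem_insert.1 (hsub hx) with rfl | hx'
      · obtain ⟨i, hi, hx⟩ := (memN _ _).1 (Finset.mem_inter.1 hx).1
        exact absurd hx (hno i hi)
      · exact hx'
    exact absurd ((h Q hQS).trans (Finset.card_le_card this)) (by simpa [hN] using hlt)
  obtain ⟨w, hwp, hwI, hwQ⟩ :
      ∃ w ∈ linSupp (lo p) (hi p), w ∈ Finset.Icc v m ∧ w ∉ N Q := by
    by_contra! hno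
    have h1 := h (insert p Q) (Finset.insert_subset hpS hQS)
    rw [Finset.card_insert_of_notMem hpQ] at h1
    have : N (insert p Q) ∩ Finset.Icc v m ⊆ N Q ∩ Finset.Icc v m := by
      intro x hx
      obtain ⟨hx, hxI⟩ := Finset.mem_inter.1 hx
      obtain ⟨i, hiQ, hxi⟩ := (memN _ _).1 hx
      refine Finset.mem_inter.2 ⟨?_, hxI⟩
      rcases Finset.mem_insert.1 hiQ with rfl | hiQ
      · exact hno x hxi hxI
      · exact (memN _ _).2 ⟨i, hiQ, hxi⟩
    have h2 := Finset.card_le_card this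
    simp only [hN] at h2 htight
    omega
  have hws : w ∉ linSupp (lo s) (hi s) := fun h => hwQ ((memN _ _).2 ⟨s, hsQ, h⟩)
  rw [Finset.mem_Icc] at hwI
  have hs := hmax s (hQS hsQ) hsv
  have hsp := hnc s (hQS hsQ) p hpS
  have hps := hnc p hpS s (hQS hsQ)
  have hs2 := hlo s (hQS hsQ)
  have hp2 := hlo p hpS
  have hsn := hhi s (hQS hsQ)
  have hpn := hhi p hpS
  rw [mem_linSupp] at hpv hsv hwp hws
  simp only [linKey] at hs
  have hlop : lo p = v ∨ lo p + 1 = v := by split_ifs at hs <;> omega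
  have hw : w = hi p ∨ w = hi p + 1 := by split_ifs at hs <;> omega
  have hsin : lo p ≤ lo s ∧ hi s ≤ hi p := by split_ifs at hs <;> omega
  set A := Q.filter fun i => lo p ≤ lo i ∧ hi i ≤ hi p with hA
  set B := Q.filter fun i => ¬ (lo p ≤ lo i ∧ hi i ≤ hi p) with hB
  have hAQ : A ⊆ Q := Finset.filter_subset _ _
  have hBQ : B ⊆ Q := Finset.filter_subset _ _
  have hcard : A.card + B.card = Q.card := Finset.card_filter_add_card_filter_not _
  have hdA := hdense A (hAQ.trans hQS) ⟨s, by simp [hA, hsQ, hsin]⟩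
  have hhB := h B (hBQ.trans hQS)
  have hNA : ∀ x ∈ N A, lo p ≤ x ∧ x ≤ hi p + 1 := by
    intro x hx
    obtain ⟨i, hi', hx⟩ := (memN _ _).1 hx
    have := (Finset.mem_filter.1 hi').2
    have := hlo i (hQS (hAQ hi'))
    rw [mem_linSupp] at hx
    omega
  have hNB : ∀ x ∈ N B ∩ Finset.Icc v m, hi p ≤ x := by
    intro x hx
    obtain ⟨hx, hxI⟩ := Finset.mem_inter.1 hx
    obtain ⟨i, hi', hx⟩ := (memN _ _).1 hx
    have hiS := hQS (hBQ hi')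
    have h1 := (Finset.mem_filter.1 hi').2
    have h2 := hlo i hiS
    have h3 := hhi i hiS
    have h4 := hnc i hiS p hpS
    have h5 := hnc p hpS i hiS
    have h6 := hmax i hiS
    rw [mem_linSupp] at hx
    exact le_of_linKey_le (n := n) hlop hp2 h2 hpn h3 h4 h5 (fun h => h6 (mem_linSupp.2 h)) h1 hx
      (Finset.mem_Icc.1 hxI).1
  have hwA : w ∉ N A := fun h =>
    hwQ <| by obtain ⟨i, hi, hx⟩ := (memN _ _).1 h; exact (memN _ _).2 ⟨i, hAQ hi, hx⟩
  have hunion : (N A ∩ Finset.Icc v m) ∪ (N B ∩ Finset.Icc v m) ⊆ N Q ∩ Finset.Icc v m := by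
    intro x hx
    simp only [Finset.mem_union, Finset.mem_inter, memN] at hx ⊢
    rcases hx with ⟨⟨i, hi, hx⟩, h⟩ | ⟨⟨i, hi, hx⟩, h⟩
    · exact ⟨⟨i, hAQ hi, hx⟩, h⟩
    · exact ⟨⟨i, hBQ hi, hx⟩, h⟩
  have hu := Finset.card_le_card hunion
  have hui := Finset.card_union_add_card_inter (N A ∩ Finset.Icc v m) (N B ∩ Finset.Icc v m)
  have hloss : N A ⊆ (N A ∩ Finset.Icc v m) ∪ ({lo p, hi p + 1} : Finset ℕ).filter
      (fun x => x ∉ Finset.Icc v m) := by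
    intro x hx
    have := hNA x hx
    simp only [Finset.mem_union, Finset.mem_inter, Finset.mem_filter, Finset.mem_insert,
      Finset.mem_singleton, Finset.mem_Icc, hx, true_and]
    omega
  have hl := (Finset.card_le_card hloss).trans (Finset.card_union_le _ _)
  have hint : (N A ∩ Finset.Icc v m) ∩ (N B ∩ Finset.Icc v m) ⊆
      (({hi p, hi p + 1} : Finset ℕ).erase w).filter (fun x => x ≤ m) := by
    intro x hx
    obtain ⟨hxA, hxB⟩ := Finset.mem_inter.1 hx
    have h1 := hNB x hxB
    obtain ⟨hxA, hxI⟩ := Finset.mem_inter.1 hxA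
    have h2 := hNA x hxA
    have h3 : x ≠ w := by rintro rfl; exact hwA hxA
    rw [Finset.mem_Icc] at hxI
    simp only [Finset.mem_filter, Finset.mem_erase, Finset.mem_insert, Finset.mem_singleton]
    omega
  have hi' := Finset.card_le_card hint
  change A.card + 3 ≤ (N A).card at hdA
  change B.card ≤ (N B ∩ Finset.Icc v m).card at hhB
  rcases (show hi p ≤ m by omega).eq_or_lt with hm | hm
  · have e1 : (({lo p, hi p + 1} : Finset ℕ).filter (fun x => x ∉ Finset.Icc v m)).card ≤ 2 :=
      (Finset.card_filter_le _ _).trans Finset.card_le_two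
    have e2 : (({hi p, hi p + 1} : Finset ℕ).erase w).filter (fun x => x ≤ m) = ∅ := by
      ext x
      simp only [Finset.mem_filter, Finset.mem_erase, Finset.mem_insert, Finset.mem_singleton,
        Finset.notMem_empty, iff_false]
      omega
    rw [e2, Finset.card_empty] at hi'
    omega
  · have e1 : (({lo p, hi p + 1} : Finset ℕ).filter (fun x => x ∉ Finset.Icc v m)).card ≤ 1 := by
      refine (Finset.card_le_card (t := {lo p}) fun x => ?_).trans (Finset.card_singleton _).le
      simp only [Finset.mem_filter, Finset.mem_insert, Finset.mem_singleton, Finset.mem_Icc]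
      omega
    have e2 : ((({hi p, hi p + 1} : Finset ℕ).erase w).filter (fun x => x ≤ m)).card ≤ 1 := by
      refine (Finset.card_filter_le _ _).trans ?_
      rw [Finset.card_erase_of_mem (by simpa using hw)]
      have := Finset.card_le_two (a := hi p) (b := hi p + 1)
      omega
    omega

end LinearMatching

section Coordinates

variable {n : ℕ}

/-- The smaller edge of a propagator. -/
def loEdge (p : Prp n) : ℕ :=
  Sym2.lift ⟨fun i j => min i.val j.val, fun _ _ => min_comm _ _⟩ p

/-- The larger edge of a propagator. -/
def hiEdge (p : Prp n) : ℕ :=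
  Sym2.lift ⟨fun i j => max i.val j.val, fun _ _ => max_comm _ _⟩ p

lemma loEdge_le_hiEdge (p : Prp n) : loEdge p ≤ hiEdge p := by
  induction p using Sym2.ind with
  | _ i j => exact min_le_max

lemma natCast_inj_of_lt {a b : ℕ} (ha : a < n) (hb : b < n) (h : (a : ZMod n) = b) : a = b := by
  have := congrArg ZMod.val h
  rwa [ZMod.val_cast_of_lt ha, ZMod.val_cast_of_lt hb] at this

lemma ord_natCast_of_le {a b : ℕ} (hab : a ≤ b) (hb : b < n) :
    ord n (a : ZMod n) (b : ZMod n) = b - a := by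
  unfold ord
  rw [← Nat.cast_sub hab, ZMod.val_cast_of_lt (by omega)]

lemma ord_natCast_of_lt {a b : ℕ} (hab : a < b) (hb : b < n) :
    ord n (b : ZMod n) (a : ZMod n) = n - (b - a) := by
  have h : ((a : ZMod n) - b) = ((n - (b - a) : ℕ) : ZMod n) := by
    rw [Nat.cast_sub (by omega), Nat.cast_sub hab.le, ZMod.natCast_self]
    ring
  unfold ord
  rw [h, ZMod.val_cast_of_lt (by omega)]

lemma otherEnd_mk_left (a b : ZMod n) : otherEnd n s(a, b) a = b := by
  have h : a ∈ s(a, b) := Sym2.mem_mk_left a b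
  rw [otherEnd, dif_pos h]
  exact Sym2.congr_right.1 (Sym2.other_spec h)

lemma otherEnd_mk_right (a b : ZMod n) : otherEnd n s(a, b) b = a := by
  rw [Sym2.eq_swap, otherEnd_mk_left]

variable [NeZero n]

lemma hiEdge_lt (p : Prp n) : hiEdge p < n := by
  induction p using Sym2.ind with
  | _ i j => exact max_lt (ZMod.val_lt i) (ZMod.val_lt j)

lemma eq_mk_edges (p : Prp n) : p = s((loEdge p : ZMod n), (hiEdge p : ZMod n)) := by
  induction p using Sym2.ind with
  | _ i j =>
    simp only [loEdge, hiEdge, Sym2.lift_mk]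
    rcases le_total i.val j.val with h | h
    · simp [min_eq_left h, max_eq_right h]
    · simp [min_eq_right h, max_eq_left h, Sym2.eq_swap]

lemma supp_eq_image (p : Prp n) :
    supp n p = (linSupp (loEdge p) (hiEdge p)).image ((↑) : ℕ → ZMod n) := by
  conv_lhs => rw [eq_mk_edges p]
  simp [supp, linSupp, Finset.image_insert]

lemma suppSet_eq_image (Q : Finset (Prp n)) :
    suppSet n Q = (Q.biUnion fun p => linSupp (loEdge p) (hiEdge p)).image
      ((↑) : ℕ → ZMod n) := by
  ext x
  simp only [suppSet, supp_eq_image, Finset.mem_biUnion, Finset.mem_image]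
  constructor
  · rintro ⟨p, hp, y, hy, rfl⟩
    exact ⟨y, ⟨p, hp, hy⟩, rfl⟩
  · rintro ⟨y, ⟨p, hp, hy⟩, rfl⟩
    exact ⟨p, hp, y, hy, rfl⟩

lemma le_of_mem_linSupp {p : Prp n} {x : ℕ} (hx : x ∈ linSupp (loEdge p) (hiEdge p)) : x ≤ n := by
  have := hiEdge_lt p
  have := loEdge_le_hiEdge p
  rw [mem_linSupp] at hx
  omega

lemma natCast_mem_supp_iff {p : Prp n} {v : ℕ} (hv1 : 1 ≤ v) (hv : v < n) :
    (v : ZMod n) ∈ supp n p ↔ v ∈ linSupp (loEdge p) (hiEdge p) := by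
  rw [supp_eq_image, Finset.mem_image]
  constructor
  · rintro ⟨y, hy, hyv⟩
    rcases (le_of_mem_linSupp hy).eq_or_lt with rfl | hlt
    · rw [ZMod.natCast_self, ← Nat.cast_zero] at hyv
      have := natCast_inj_of_lt (by omega) hv hyv
      omega
    · rwa [← natCast_inj_of_lt hlt hv hyv]
  · exact fun h => ⟨v, h, rfl⟩

lemma natCast_mem_iff {p : Prp n} {e : ℕ} (he : e < n) :
    (e : ZMod n) ∈ p ↔ e = loEdge p ∨ e = hiEdge p := by
  have h1 := hiEdge_lt p
  have h2 := loEdge_le_hiEdge p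
  conv_lhs => rw [eq_mk_edges p, Sym2.mem_iff]
  constructor
  · rintro (h | h)
    · exact Or.inl (natCast_inj_of_lt he (by omega) h)
    · exact Or.inr (natCast_inj_of_lt he h1 h)
  · rintro (h | h) <;> simp [h]

lemma otherEnd_loEdge (p : Prp n) : otherEnd n p (loEdge p : ZMod n) = (hiEdge p : ZMod n) := by
  conv_lhs => arg 2; rw [eq_mk_edges p]
  exact otherEnd_mk_left _ _

lemma otherEnd_hiEdge (p : Prp n) : otherEnd n p (hiEdge p : ZMod n) = (loEdge p : ZMod n) := by
  conv_lhs => arg 2; rw [eq_mk_edges p]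
  exact otherEnd_mk_right _ _

lemma cwKey_natCast {p : Prp n} {v : ℕ} (hv1 : 1 ≤ v) (hv : v < n)
    (hp : loEdge p + 2 ≤ hiEdge p) (hvp : v ∈ linSupp (loEdge p) (hiEdge p)) :
    cwKey n (v : ZMod n) p = linKey n v (loEdge p) (hiEdge p) := by
  have h1 := hiEdge_lt p
  have hsub : (v : ZMod n) - 1 = ((v - 1 : ℕ) : ZMod n) := by simp [Nat.cast_sub hv1]
  rw [mem_linSupp] at hvp
  unfold cwKey linKey
  have hmem := natCast_mem_iff (p := p) (e := v - 1) (by omega)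
  rw [hsub]
  by_cases hl : loEdge p + 1 = v
  · rw [if_pos (hmem.2 (by omega)), if_pos hl, ← hl, Nat.add_sub_cancel, otherEnd_loEdge,
      ord_natCast_of_le (by omega) h1]
  · rw [if_neg hl]
    by_cases hr : hiEdge p + 1 = v
    · rw [if_pos (hmem.2 (by omega)), if_pos hr, ← hr, Nat.add_sub_cancel, otherEnd_hiEdge,
        ord_natCast_of_lt (by omega) h1]
    · rw [if_neg (fun h => hr (by have := hmem.1 h; omega)), if_neg hr]
      by_cases hl' : loEdge p = v
      · rw [if_pos hl', ← hl', otherEnd_loEdge, ord_natCast_of_le (by omega) h1]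
      · rw [if_neg hl', show v = hiEdge p by omega, otherEnd_hiEdge,
          ord_natCast_of_lt (by omega) h1]

variable {P : Finset (Prp n)}

lemma IsAdmissible.linear_dense (h : IsAdmissible n P) {Q : Finset (Prp n)} (hQ : Q ⊆ P)
    (hne : Q.Nonempty) :
    Q.card + 3 ≤ (Q.biUnion fun p => linSupp (loEdge p) (hiEdge p)).card := by
  have := h.dense Q hQ hne
  rw [suppSet_eq_image] at this
  exact this.trans Finset.card_image_le

lemma IsAdmissible.loEdge_add_two_le (h : IsAdmissible n P) {p : Prp n} (hp : p ∈ P) :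
    loEdge p + 2 ≤ hiEdge p := by
  have h1 := h.linear_dense (Finset.singleton_subset_iff.2 hp) (Finset.singleton_nonempty p)
  rw [Finset.singleton_biUnion, Finset.card_singleton] at h1
  have h2 := loEdge_le_hiEdge p
  by_contra! hlt
  have hsub : linSupp (loEdge p) (hiEdge p) ⊆ {loEdge p, loEdge p + 1, loEdge p + 2} := by
    intro x hx
    rw [mem_linSupp] at hx
    simp only [Finset.mem_insert, Finset.mem_singleton]
    omega
  have := (Finset.card_le_card hsub).trans Finset.card_le_three
  omega

lemma IsAdmissible.linear_noncross (h : IsAdmissible n P) {p q : Prp n} (hp : p ∈ P)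
    (hq : q ∈ P) :
    ¬ (loEdge p < loEdge q ∧ loEdge q < hiEdge p ∧ hiEdge p < hiEdge q) := by
  rintro ⟨h1, h2, h3⟩
  have h4 := hiEdge_lt p
  have h5 := hiEdge_lt q
  refine h.noncross p hp q hq ⟨_, _, _, _, eq_mk_edges p, eq_mk_edges q, ?_⟩
  rw [ord_natCast_of_le h1.le (by omega), ord_natCast_of_le (by omega) h4,
    ord_natCast_of_le (by omega) h5]
  omega

end Coordinates

section Algorithm

variable {n : ℕ}

lemma pickCW_eq_none_iff {S : Finset (Prp n)} {a : ZMod n} :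
    pickCW n S a = none ↔ ∀ p ∈ S, a ∉ supp n p := by
  unfold pickCW
  split_ifs with h
  · obtain ⟨p, hp⟩ := h
    rw [Finset.mem_filter] at hp
    simpa using ⟨p, hp⟩
  · simpa [Finset.not_nonempty_iff_eq_empty, Finset.filter_eq_empty_iff] using h

lemma pickCW_spec {S : Finset (Prp n)} {a : ZMod n} {p : Prp n} (h : pickCW n S a = some p) :
    (p ∈ S ∧ a ∈ supp n p) ∧ ∀ q ∈ S, a ∈ supp n q → cwKey n a q ≤ cwKey n a p := by
  unfold pickCW at h
  split_ifs at h with hne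
  obtain rfl := Option.some.inj h
  have := Classical.choose_spec
    ((S.filter fun p => a ∈ supp n p).exists_max_image (cwKey n a) hne)
  exact ⟨Finset.mem_filter.1 this.1, fun q hq ha => this.2 q (Finset.mem_filter.2 ⟨hq, ha⟩)⟩

lemma pickCW_insert_of_notMem {S : Finset (Prp n)} {a : ZMod n} {p : Prp n}
    (ha : a ∉ supp n p) : pickCW n (insert p S) a = pickCW n S a := by
  have : ((insert p S).filter fun q => a ∈ supp n q) = S.filter fun q => a ∈ supp n q := by
    rw [Finset.filter_insert, if_neg ha]
  unfold pickCW
  simp only [this]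

lemma pickCW_singleton {a : ZMod n} {p : Prp n} (ha : a ∈ supp n p) :
    pickCW n {p} a = some p := by
  cases h : pickCW n {p} a with
  | none => exact absurd ha (pickCW_eq_none_iff.1 h p (Finset.mem_singleton_self p))
  | some q => rw [Finset.mem_singleton.1 (pickCW_spec h).1.1]

variable {P : Finset (Prp n)} {i : ZMod n} {t : ℕ}

lemma gnRun_succ_of_none (h : pickCW n (gnRun n P i t).1 (i + (t : ZMod n)) = none) :
    gnRun n P i (t + 1) = gnRun n P i t := by
  rw [gnRun, h]

lemma gnRun_succ_of_some {p : Prp n}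
    (h : pickCW n (gnRun n P i t).1 (i + (t : ZMod n)) = some p) :
    gnRun n P i (t + 1) = ((gnRun n P i t).1.erase p,
      Function.update (gnRun n P i t).2 p (some (i + (t : ZMod n)))) := by
  rw [gnRun, h]

lemma gnRun_fst_subset : (gnRun n P i t).1 ⊆ P := by
  induction t with
  | zero => exact subset_rfl
  | succ t ih =>
    cases h : pickCW n (gnRun n P i t).1 (i + (t : ZMod n)) with
    | none => rwa [gnRun_succ_of_none h]
    | some p =>
      rw [gnRun_succ_of_some h]
      exact (Finset.erase_subset _ _).trans ih

lemma gnRun_eq_of_fst_eq_empty (h : (gnRun n P i t).1 = ∅) {t' : ℕ} (ht : t ≤ t') :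
    gnRun n P i t' = gnRun n P i t := by
  induction t', ht using Nat.le_induction with
  | base => rfl
  | succ t' _ ih =>
    rw [← ih] at h ⊢
    exact gnRun_succ_of_none (pickCW_eq_none_iff.2 (by simp [h]))

lemma gnRun_snd_eq_some {p : Prp n} {v : ZMod n} (h : (gnRun n P i t).2 p = some v) :
    p ∈ P ∧ ∃ j < t, v = i + (j : ZMod n) := by
  induction t with
  | zero => simp [gnRun] at h
  | succ t ih =>
    have of_prev (h : (gnRun n P i t).2 p = some v) :
        p ∈ P ∧ ∃ j < t + 1, v = i + (j : ZMod n) := by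
      obtain ⟨hp, j, hj, hv⟩ := ih h
      exact ⟨hp, j, by omega, hv⟩
    cases hpick : pickCW n (gnRun n P i t).1 (i + (t : ZMod n)) with
    | none =>
      rw [gnRun_succ_of_none hpick] at h
      exact of_prev h
    | some q =>
      rw [gnRun_succ_of_some hpick] at h
      dsimp only at h
      by_cases hpq : p = q
      · subst hpq
        rw [Function.update_self, Option.some_inj] at h
        exact ⟨gnRun_fst_subset (pickCW_spec hpick).1.1, t, by omega, h.symm⟩
      · rw [Function.update_of_ne hpq] at h
        exact of_prev h

lemma gnRun_insert {p : Prp n} (hp : p ∉ P) (hsupp : ∀ j < t, i + (j : ZMod n) ∉ supp n p) :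
    gnRun n (insert p P) i t = (insert p (gnRun n P i t).1, (gnRun n P i t).2) := by
  induction t with
  | zero => rfl
  | succ t ih =>
    specialize ih fun j hj => hsupp j (by omega)
    have hpick : pickCW n (gnRun n (insert p P) i t).1 (i + (t : ZMod n)) =
        pickCW n (gnRun n P i t).1 (i + (t : ZMod n)) := by
      rw [ih]
      exact pickCW_insert_of_notMem (hsupp t (by omega))
    cases h : pickCW n (gnRun n P i t).1 (i + (t : ZMod n)) with
    | none => rw [gnRun_succ_of_none (hpick.trans h), gnRun_succ_of_none h, ih]
    | some q =>
      have hqp : p ≠ q := by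
        rintro rfl
        exact hp (gnRun_fst_subset (pickCW_spec h).1.1)
      rw [gnRun_succ_of_some (hpick.trans h), gnRun_succ_of_some h, ih]
      simp only [Finset.erase_insert_of_ne hqp]

lemma mem_supp_last_iff {x : ZMod n} :
    x ∈ supp n (s(-3, -1) : Prp n) ↔ x = -3 ∨ x = -2 ∨ x = -1 ∨ x = 0 := by
  simp [supp, show (-3 : ZMod n) + 1 = -2 by ring]

variable [NeZero n]

lemma HallFrom.gnRun (hadm : IsAdmissible n P) {V : Finset (Prp n)} (hVP : V ⊆ P) {m : ℕ}
    (hm : m < n) (hV : HallFrom loEdge hiEdge V 1 m) (ht : t ≤ m) :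
    HallFrom loEdge hiEdge (gnRun n V 1 t).1 (t + 1) m := by
  induction t with
  | zero => exact hV
  | succ t ih =>
    specialize ih (by omega)
    have hvert : (1 : ZMod n) + (t : ZMod n) = ((t + 1 : ℕ) : ZMod n) := by
      push_cast
      ring
    have hS : (WLD.gnRun n V 1 t).1 ⊆ P := gnRun_fst_subset.trans hVP
    have hmem (q : Prp n) : (1 : ZMod n) + (t : ZMod n) ∈ supp n q ↔
        t + 1 ∈ linSupp (loEdge q) (hiEdge q) := by
      rw [hvert, natCast_mem_supp_iff (by omega) (by omega)]
    cases h : pickCW n (WLD.gnRun n V 1 t).1 (1 + (t : ZMod n)) with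
    | none =>
      rw [gnRun_succ_of_none h]
      exact ih.succ_of_notMem fun q hq hv => pickCW_eq_none_iff.1 h q hq ((hmem q).2 hv)
    | some p =>
      obtain ⟨⟨hpS, hpv⟩, hmax⟩ := pickCW_spec h
      rw [gnRun_succ_of_some h]
      refine ih.succ_erase (n := n) ht (by omega)
        (fun q hq => hadm.loEdge_add_two_le (hS hq)) (fun q _ => hiEdge_lt q)
        (fun q hq r hr => hadm.linear_noncross (hS hq) (hS hr))
        (fun Q hQ => hadm.linear_dense (hQ.trans hS)) hpS ((hmem p).1 hpv) fun q hq hqv => ?_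
      have := hmax q hq ((hmem q).2 hqv)
      rwa [hvert, cwKey_natCast (by omega) (by omega) (hadm.loEdge_add_two_le (hS hq)) hqv,
        cwKey_natCast (by omega) (by omega) (hadm.loEdge_add_two_le (hS hpS)) ((hmem p).1 hpv)]
        at this

lemma HallFrom.gnRun_fst_eq_empty (hadm : IsAdmissible n P) {V : Finset (Prp n)} (hVP : V ⊆ P)
    {m : ℕ} (hm : m < n) (hV : HallFrom loEdge hiEdge V 1 m) : (WLD.gnRun n V 1 m).1 = ∅ := by
  have := HallFrom.gnRun hadm hVP hm hV le_rfl _ subset_rfl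
  simpa using this

/-- Density together with the propagator `(n-3, n-1)`, whose support is disjoint from
`1, …, n-4`, gives Hall's condition on these vertices for the remaining propagators. -/
lemma IsAdmissible.hallFrom_eraseP (hadm : IsAdmissible n P) (hp : (s(-3, -1) : Prp n) ∈ P) :
    HallFrom loEdge hiEdge (eraseP n P) 1 (n - 4) := by
  intro Q hQ
  have hn := hadm.card_add_four_le
  have hpQ : (s(-3, -1) : Prp n) ∉ Q := fun h => (Finset.mem_erase.1 (hQ h)).1 rfl
  have hdense := hadm.dense (insert s(-3, -1) Q)
    (Finset.insert_subset hp (hQ.trans (Finset.erase_subset _ _))) (Finset.insert_nonempty _ _)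
  rw [Finset.card_insert_of_notMem hpQ] at hdense
  set N := (Q.biUnion fun p => linSupp (loEdge p) (hiEdge p)) with hN
  have hsub : suppSet n (insert s(-3, -1) Q) ⊆
      (N ∩ Finset.Icc 1 (n - 4)).image ((↑) : ℕ → ZMod n) ∪ {-3, -2, -1, 0} := by
    intro x hx
    rw [suppSet, Finset.biUnion_insert, Finset.mem_union, mem_supp_last_iff] at hx
    rw [Finset.mem_union]
    rcases hx with hx | hx
    · exact Or.inr (by simpa using hx)
    · change x ∈ suppSet n Q at hx
      rw [suppSet_eq_image, Finset.mem_image] at hx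
      obtain ⟨y, hy, rfl⟩ := hx
      by_cases hyI : y ∈ Finset.Icc 1 (n - 4)
      · exact Or.inl (Finset.mem_image_of_mem _ (Finset.mem_inter.2 ⟨hy, hyI⟩))
      · right
        obtain ⟨q, -, hq⟩ := Finset.mem_biUnion.1 hy
        have hyn := le_of_mem_linSupp hq
        rw [Finset.mem_Icc] at hyI
        have : y = 0 ∨ y + 3 = n ∨ y + 2 = n ∨ y + 1 = n ∨ y = n := by omega
        have cast_eq (k : ℕ) (h : y + k = n) : (y : ZMod n) = -(k : ZMod n) := by
          rw [eq_neg_iff_add_eq_zero, ← Nat.cast_add, h, ZMod.natCast_self]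
        rcases this with h | h | h | h | h
        · simp [h]
        · simp [cast_eq _ h]
        · simp [cast_eq _ h]
        · simp [cast_eq _ h]
        · simp [h]
  have h1 := (Finset.card_le_card hsub).trans (Finset.card_union_le _ _)
  have h2 : ((N ∩ Finset.Icc 1 (n - 4)).image ((↑) : ℕ → ZMod n)).card ≤ _ :=
    Finset.card_image_le
  have h3 : ({-3, -2, -1, 0} : Finset (ZMod n)).card ≤ 4 := Finset.card_le_four
  omega

end Algorithm

section Shape

variable {n : ℕ}

lemma ord_one_neg {k : ℕ} (hk : k < n) : ord n 1 (-(k : ZMod n)) = n - 1 - k := by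
  have h : -(k : ZMod n) - 1 = ((n - 1 - k : ℕ) : ZMod n) := by
    rw [Nat.cast_sub (by omega), Nat.cast_sub (by omega), ZMod.natCast_self]
    push_cast
    ring
  unfold ord
  rw [h, ZMod.val_cast_of_lt (by omega)]

variable [NeZero n] {P : Finset (Prp n)}

lemma ord_injective (i : ZMod n) : Function.Injective (ord n i) := fun _ _ h =>
  sub_left_injective (ZMod.val_injective n h)

lemma mem_gnSet_iff {i v : ZMod n} : v ∈ gnSet n P i ↔ ∃ p, (gnRun n P i n).2 p = some v := by
  rw [gnSet, Finset.mem_filter]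
  simp only [Finset.mem_univ, true_and, gnAssign]

lemma IsAdmissible.gnRun_eraseP (hadm : IsAdmissible n P) (hp : (s(-3, -1) : Prp n) ∈ P) :
    (gnRun n (eraseP n P) 1 (n - 4)).1 = ∅ :=
  HallFrom.gnRun_fst_eq_empty hadm (Finset.erase_subset _ _)
    (by have := hadm.card_add_four_le; omega) (hadm.hallFrom_eraseP hp)

lemma IsAdmissible.ord_lt_of_mem_gnSet_eraseP (hadm : IsAdmissible n P)
    (hp : (s(-3, -1) : Prp n) ∈ P) {v : ZMod n} (hv : v ∈ gnSet n (eraseP n P) 1) :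
    ord n 1 v < n - 4 := by
  obtain ⟨q, hq⟩ := mem_gnSet_iff.1 hv
  rw [gnRun_eq_of_fst_eq_empty (hadm.gnRun_eraseP hp) (Nat.sub_le _ _)] at hq
  obtain ⟨-, j, hj, rfl⟩ := gnRun_snd_eq_some hq
  rw [ord, add_sub_cancel_left, ZMod.val_cast_of_lt (by omega)]
  exact hj

/-- The propagator `(n-3, n-1)` contributes the vertex `n-3` to the first necklace term and does
not affect the contribution of the others. -/
lemma IsAdmissible.gnSet_eq_insert (hadm : IsAdmissible n P) (hp : (s(-3, -1) : Prp n) ∈ P) :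
    gnSet n P 1 = insert (-3) (gnSet n (eraseP n P) 1) := by
  have hn := hadm.card_add_four_le
  have hpos : 0 < P.card := Finset.card_pos.2 ⟨_, hp⟩
  have hV := hadm.gnRun_eraseP hp
  have hpV : (s(-3, -1) : Prp n) ∉ eraseP n P := Finset.notMem_erase _ _
  have hlast : (1 : ZMod n) + ((n - 4 : ℕ) : ZMod n) = -3 := by
    rw [Nat.cast_sub (by omega), ZMod.natCast_self]
    push_cast
    ring
  have hrun : gnRun n P 1 (n - 4) = ({s(-3, -1)}, (gnRun n (eraseP n P) 1 (n - 4)).2) := by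
    have := gnRun_insert (i := 1) (t := n - 4) hpV fun j hj hmem => by
      have hord : ord n 1 ((1 : ZMod n) + (j : ZMod n)) = j := by
        rw [ord, add_sub_cancel_left, ZMod.val_cast_of_lt (by omega)]
      have hneg (k : ℕ) (hk : k < 4) : (1 : ZMod n) + (j : ZMod n) ≠ -(k : ZMod n) := fun h => by
        rw [h, ord_one_neg (by omega)] at hord
        omega
      rcases mem_supp_last_iff.1 hmem with h | h | h | h
      · exact hneg 3 (by omega) (by simpa using h)
      · exact hneg 2 (by omega) (by simpa using h)
      · exact hneg 1 (by omega) (by simpa using h)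
      · exact hneg 0 (by omega) (by simpa using h)
    rwa [hV, eraseP, Finset.insert_erase hp] at this
  have hpick : pickCW n (gnRun n P 1 (n - 4)).1 (1 + ((n - 4 : ℕ) : ZMod n)) =
      some s(-3, -1) := by
    rw [hrun, hlast]
    exact pickCW_singleton (mem_supp_last_iff.2 (Or.inl rfl))
  have hsucc := gnRun_succ_of_some hpick
  rw [hrun, hlast] at hsucc
  have hfinal : gnRun n P 1 n = gnRun n P 1 (n - 4 + 1) :=
    gnRun_eq_of_fst_eq_empty (by rw [hsucc]; simp) (by omega)
  have hnone : (gnRun n (eraseP n P) 1 (n - 4)).2 s(-3, -1) = none :=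
    Option.eq_none_iff_forall_ne_some.2 fun v hv => hpV (gnRun_snd_eq_some hv).1
  ext v
  rw [Finset.mem_insert, mem_gnSet_iff, mem_gnSet_iff, hfinal, hsucc,
    gnRun_eq_of_fst_eq_empty hV (Nat.sub_le _ _)]
  dsimp only
  constructor
  · rintro ⟨q, hq⟩
    by_cases hqp : q = s(-3, -1)
    · subst hqp
      rw [Function.update_self, Option.some_inj] at hq
      exact Or.inl hq.symm
    · rw [Function.update_of_ne hqp] at hq
      exact Or.inr ⟨q, hq⟩
  · rintro (rfl | ⟨q, hq⟩)
    · exact ⟨s(-3, -1), Function.update_self _ _ _⟩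
    · refine ⟨q, ?_⟩
      rwa [Function.update_of_ne]
      rintro rfl
      rw [hnone] at hq
      cases hq

end Shape

/-- shapes of the Le diagrams of `V` and `W`.
Under the Setup: the shape of the Le diagram of `V` consists, from left to
right, of a rectangle that is 3 columns wide (columns `n, n-1, n-2`, all of full
height), one further column (`n-3`) of the same height, and a partition shape
with at most as many rows as the rectangle; the shape of the Le diagram of `W`
consists, from left to right, of a rectangle with 3 columns and one more row
(the new row being labelled `n-3`, of length exactly 3), followed by the same
partition shape as in `V`. -/
theorem leDiagram_shape_of_erase_good_propagator
    (n : ℕ) [NeZero n] (P : Finset (Prp n))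
    (hadm : IsAdmissible n P) (hne : P.Nonempty)
    (hp : (s(-3, -1) : Prp n) ∈ P)
    (hlen : plength n (s(-3, -1) : Prp n) = 2)
    (hin : ∀ r ∈ P, InsideDir n (-3) (s(-3, -1) : Prp n) r → r = (s(-3, -1) : Prp n))
    (hedge : (∀ r ∈ P, (-3 : ZMod n) ∈ r → r = (s(-3, -1) : Prp n)) ∨
      ((s(-5, -3) : Prp n) ∈ P ∧ plength n (s(-5, -3) : Prp n) = 2 ∧
        (∀ r ∈ P, (-3 : ZMod n) ∈ r →
          r = (s(-3, -1) : Prp n) ∨ r = (s(-5, -3) : Prp n)) ∧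
        (∀ r ∈ P, InsideDir n (-5) (s(-5, -3) : Prp n) r → r = (s(-5, -3) : Prp n))))
    :
    ((0 : ZMod n) ∉ gnSet n (eraseP n P) 1 ∧ (-1 : ZMod n) ∉ gnSet n (eraseP n P) 1 ∧
      (-2 : ZMod n) ∉ gnSet n (eraseP n P) 1 ∧ (-3 : ZMod n) ∉ gnSet n (eraseP n P) 1) ∧
    gnSet n P 1 = insert (-3) (gnSet n (eraseP n P) 1) ∧
    rowLen n (gnSet n P 1) (-3) = 3 ∧
    ∀ a ∈ gnSet n (eraseP n P) 1,
      rowLen n (gnSet n P 1) a + 1 = rowLen n (gnSet n (eraseP n P) 1) a := by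
  have hn := hadm.card_add_four_le
  have hpos := hne.card_pos
  have h3 : ord n 1 (-3) = n - 4 := by
    simpa [Nat.sub_sub] using ord_one_neg (n := n) (k := 3) (by omega)
  have h2 : ord n 1 (-2) = n - 3 := by
    simpa [Nat.sub_sub] using ord_one_neg (n := n) (k := 2) (by omega)
  have h1 : ord n 1 (-1) = n - 2 := by
    simpa [Nat.sub_sub] using ord_one_neg (n := n) (k := 1) (by omega)
  have h0 : ord n 1 0 = n - 1 := by
    simpa using ord_one_neg (n := n) (k := 0) (by omega)
  have hlt {v : ZMod n} (hv : v ∈ gnSet n (eraseP n P) 1) : ord n 1 v < n - 4 :=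
    hadm.ord_lt_of_mem_gnSet_eraseP hp hv
  have hset := hadm.gnSet_eq_insert hp
  have hn3 : (-3 : ZMod n) ∉ gnSet n (eraseP n P) 1 := fun h => by have := hlt h; omega
  refine ⟨⟨fun h => ?_, fun h => ?_, fun h => ?_, hn3⟩, hset, ?_, fun a ha => ?_⟩
  · have := hlt h
    omega
  · have := hlt h
    omega
  · have := hlt h
    omega
  · rw [rowLen, Finset.card_eq_three]
    refine ⟨0, -1, -2, fun h => ?_, fun h => ?_, fun h => ?_, ?_⟩
    · rw [h] at h0
      omega
    · rw [h] at h0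
      omega
    · rw [h] at h1
      omega
    · ext b
      have hb : ord n 1 b < n := ZMod.val_lt _
      have inj {x : ZMod n} : b = x ↔ ord n 1 b = ord n 1 x := (ord_injective 1).eq_iff.symm
      have hbV : b ∈ gnSet n (eraseP n P) 1 → ord n 1 b < n - 4 := hlt
      rw [Finset.mem_filter, hset]
      simp only [Finset.mem_univ, true_and, Finset.mem_insert, Finset.mem_singleton, inj, h0, h1,
        h2, h3]
      by_cases hbm : b ∈ gnSet n (eraseP n P) 1
      · have := hbV hbm
        omega
      · simp only [hbm, or_false]
        omega
  · have hins : (Finset.univ.filter fun b =>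
        b ∉ gnSet n (eraseP n P) 1 ∧ ord n 1 a < ord n 1 b) =
        insert (-3) (Finset.univ.filter fun b => b ∉ gnSet n P 1 ∧ ord n 1 a < ord n 1 b) := by
      ext b
      simp only [hset, Finset.mem_filter, Finset.mem_univ, true_and, Finset.mem_insert, not_or]
      by_cases hb : b = -3
      · simpa [hb, hn3, h3] using hlt ha
      · simp [hb]
    rw [rowLen, rowLen, hins, Finset.card_insert_of_notMem (by simp [hset])]

end WLD
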